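/- arXiv:2406.04320 — 2 statements merged into one kernel-verified Lean document; each statement's English description precedes it below -/
import Mathlib

section
/- A shift-structured SSM represents any seasonal autoregressive process SAR(p, q, s) (Theorem 3, seasonal part): let p, q, s ∈ ℕ with s ≥ 1, let N ≥ max(p, q·s), and let φ₁, …, φ_p and η₁, …, η_q be arbitrary real coefficients. With the shift matrix S ∈ Matrix (Fin N) (Fin N) ℝ, input vector e₀, input x : ℕ → ℝ, and hidden state h 0 = 0, h (t+1) = S.mulVec (h t) + x (t+1) • e₀, there exists C ∈ (Fin N → ℝ) such that for all t ≥ max(p, q·s) the output y t = ∑_{i ∈ Fin N} C i · (h t) i equals ∑_{i=1}^{p} φ_i · x (t + 1 − i) + ∑_{j=1}^{q} η_j · x (t + 1 − j·s), the SAR(p, q, s) prediction with seasonal frequency s. -/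
open Matrix

/-- A shift-structured SSM represents any seasonal autoregressive process SAR(p, q, s):
with the shift matrix `S`, input vector `e₀ = Pi.single 0 1`, state dimension
`N ≥ max p (q·s)`, and the usual recurrence, there is an output vector `C` such that
for all `t ≥ max p (q·s)` the output equals the SAR(p, q, s) prediction
`∑_{i=1}^{p} φ i · x (t + 1 − i) + ∑_{j=1}^{q} η j · x (t + 1 − j·s)`. -/
theorem shift_ssm_represents_SAR {N : ℕ} [NeZero N] (p q s : ℕ) (hs : 1 ≤ s)
    (hN : max p (q * s) ≤ N) (φ η : ℕ → ℝ)
    (S : Matrix (Fin N) (Fin N) ℝ)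
    (hS : ∀ i j, S i j = if (i : ℕ) = (j : ℕ) + 1 then 1 else 0)
    (x : ℕ → ℝ) (h : ℕ → Fin N → ℝ) (h0 : h 0 = 0)
    (hrec : ∀ t, h (t + 1) =
      S.mulVec (h t) + x (t + 1) • (Pi.single (0 : Fin N) (1 : ℝ) : Fin N → ℝ)) :
    ∃ C : Fin N → ℝ,
      ∀ t, max p (q * s) ≤ t →
        ∑ i : Fin N, C i * h t i =
          (∑ i ∈ Finset.Icc 1 p, φ i * x (t + 1 - i)) +
            ∑ j ∈ Finset.Icc 1 q, η j * x (t + 1 - j * s) := by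
  have key : ∀ t, ∀ i : Fin N, (i : ℕ) < t → h t i = x (t - i) := by
    intro t
    induction t with
    | zero => intro i hi; omega
    | succ t ih =>
      intro i hi
      rw [hrec]
      simp only [Pi.add_apply, Pi.smul_apply, smul_eq_mul, Matrix.mulVec, dotProduct, hS]
      by_cases h0' : (i : ℕ) = 0
      · have hi0 : i = 0 := Fin.ext (by simpa using h0')
        subst hi0
        simp
      · have hi0 : i ≠ 0 := fun hh => h0' (by simp [hh])
        have hlt : (i : ℕ) - 1 < N := by omega
        rw [Finset.sum_eq_single (⟨(i : ℕ) - 1, hlt⟩ : Fin N)]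
        · have e1 : (i : ℕ) = (i : ℕ) - 1 + 1 := by omega
          rw [if_pos e1, ih _ (by simp only; omega), Pi.single_eq_of_ne hi0]
          have e2 : t - ((i : ℕ) - 1) = t + 1 - i := by omega
          simp [e2]
        · intro b _ hb
          rw [if_neg, zero_mul]
          intro hh
          exact hb (Fin.ext (by simp only; omega))
        · simp
  have key2 : ∀ t d : ℕ, ∀ a : ℝ, 1 ≤ d → d ≤ N → d ≤ t →
      ∑ k : Fin N, (if (k : ℕ) + 1 = d then a else 0) * h t k = a * x (t + 1 - d) := by
    intro t d a h1 h2 h3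
    have hlt : d - 1 < N := by omega
    rw [Finset.sum_eq_single (⟨d - 1, hlt⟩ : Fin N)]
    · have e1 : d - 1 + 1 = d := by omega
      have e2 : t - (d - 1) = t + 1 - d := by omega
      rw [if_pos e1, key _ _ (by simp only; omega)]
      simp only [e2]
    · intro b _ hb
      rw [if_neg, zero_mul]
      intro hh
      exact hb (Fin.ext (by simp only; omega))
    · simp
  refine ⟨fun k => (∑ i ∈ Finset.Icc 1 p, if (k : ℕ) + 1 = i then φ i else 0) +
    ∑ j ∈ Finset.Icc 1 q, if (k : ℕ) + 1 = j * s then η j else 0, fun t ht => ?_⟩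
  have hp := le_trans (le_max_left p (q * s)) hN
  have hq := le_trans (le_max_right p (q * s)) hN
  have hp' := le_trans (le_max_left p (q * s)) ht
  have hq' := le_trans (le_max_right p (q * s)) ht
  simp only [add_mul, Finset.sum_add_distrib, Finset.sum_mul]
  congr 1
  · rw [Finset.sum_comm]
    refine Finset.sum_congr rfl fun i hi => ?_
    rw [Finset.mem_Icc] at hi
    exact key2 t i _ hi.1 (by omega) (by omega)
  · rw [Finset.sum_comm]
    refine Finset.sum_congr rfl fun j hj => ?_
    rw [Finset.mem_Icc] at hj
    have := Nat.mul_le_mul_right s hj.2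
    exact key2 t (j * s) _ (Nat.mul_pos hj.1 hs) (by omega) (by omega)
end

section
/- Bi-directional time-varying SSMs realize quasi-separable matrix multiplication (the quasi-separable block of Section 3.2): let Aᶠ, Aᵇ : ℕ → Matrix (Fin n) (Fin n) ℝ, Bᶠ, Bᵇ : ℕ → (Fin n → ℝ), Cᶠ, Cᵇ : ℕ → (Fin n → ℝ), and scalar inputs x : Fin V → ℝ indexed by variates 1, …, V. Define the forward states hᶠ 0 = 0, hᶠ v = (Aᶠ v).mulVec (hᶠ (v−1)) + x v • (Bᶠ v) for v = 1, …, V, and the backward states hᵇ (V+1) = 0, hᵇ v = (Aᵇ v).mulVec (hᵇ (v+1)) + x v • (Bᵇ v) for v = V, …, 1, with output y v = Cᶠ v ⬝ hᶠ v + Cᵇ v ⬝ hᵇ v. Then y v = ∑_{u=1}^{v} (Cᶠ v ⬝ (Aᶠ v ⋯ Aᶠ (u+1)).mulVec (Bᶠ u)) · x u + ∑_{u=v}^{V} (Cᵇ v ⬝ (Aᵇ v ⋯ Aᵇ (u−1)).mulVec (Bᵇ u)) · x u; i.e., the bidirectional map x ↦ y is multiplication by a quasi-separable matrix whose lower-triangular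 part comes from the forward pass and whose upper-triangular part comes from the backward pass. -/
open Matrix

/-- Bi-directional time-varying SSMs realize quasi-separable matrix multiplication:
running a forward recurrence over variates `v = 1, …, V` and a backward recurrence over
`v = V, …, 1` and summing the outputs, the map `x ↦ y` is multiplication by a
quasi-separable matrix: `y v = ∑_{u=1}^{v} (Cᶠ v ⬝ (Aᶠ v ⋯ Aᶠ (u+1)) Bᶠ u) x u
+ ∑_{u=v}^{V} (Cᵇ v ⬝ (Aᵇ v ⋯ Aᵇ (u−1)) Bᵇ u) x u`, where `Pf v u` (resp. `Pb v u`)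
denotes the forward (resp. backward) ordered product, the identity when empty. -/
theorem bidirectional_ssm_quasiseparable {n : ℕ} (V : ℕ)
    (Af Ab : ℕ → Matrix (Fin n) (Fin n) ℝ) (Bf Bb Cf Cb : ℕ → Fin n → ℝ)
    (x : ℕ → ℝ)
    (hf : ℕ → Fin n → ℝ) (hf0 : hf 0 = 0)
    (hfrec : ∀ v, 1 ≤ v → v ≤ V →
      hf v = (Af v).mulVec (hf (v - 1)) + x v • Bf v)
    (hb : ℕ → Fin n → ℝ) (hbV : hb (V + 1) = 0)
    (hbrec : ∀ v, 1 ≤ v → v ≤ V →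
      hb v = (Ab v).mulVec (hb (v + 1)) + x v • Bb v)
    (y : ℕ → ℝ)
    (hy : ∀ v, y v = (∑ i : Fin n, Cf v i * hf v i) + ∑ i : Fin n, Cb v i * hb v i)
    (Pf : ℕ → ℕ → Matrix (Fin n) (Fin n) ℝ)
    (hPfdiag : ∀ v, Pf v v = 1)
    (hPfstep : ∀ v u, u ≤ v → Pf (v + 1) u = Af (v + 1) * Pf v u)
    (Pb : ℕ → ℕ → Matrix (Fin n) (Fin n) ℝ)
    (hPbdiag : ∀ v, Pb v v = 1)
    (hPbstep : ∀ v u, v ≤ u → Pb v (u + 1) = Pb v u * Ab u) :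
    ∀ v, 1 ≤ v → v ≤ V →
      y v =
        (∑ u ∈ Finset.Icc 1 v,
          (∑ i : Fin n, Cf v i * ((Pf v u).mulVec (Bf u)) i) * x u) +
        ∑ u ∈ Finset.Icc v V,
          (∑ i : Fin n, Cb v i * ((Pb v u).mulVec (Bb u)) i) * x u := by
  have F : ∀ v, v ≤ V → hf v = ∑ u ∈ Finset.Icc 1 v, x u • (Pf v u).mulVec (Bf u) := by
    intro v
    induction v with
    | zero => intro _; simp [hf0]
    | succ v ih =>
      intro hv
      rw [hfrec (v + 1) (by omega) hv, Finset.sum_Icc_succ_top (by omega), hPfdiag,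
        Matrix.one_mulVec, Nat.add_sub_cancel, ih (by omega), Matrix.mulVec_sum]
      congr 1
      refine Finset.sum_congr rfl fun u hu => ?_
      rw [hPfstep v u (Finset.mem_Icc.mp hu).2, Matrix.mulVec_smul, Matrix.mulVec_mulVec]
  have B : ∀ v, 1 ≤ v → ∀ k, v ≤ k → k ≤ V + 1 →
      hb v = ∑ u ∈ Finset.Ico v k, x u • (Pb v u).mulVec (Bb u) + (Pb v k).mulVec (hb k) := by
    intro v hv k hk
    induction k, hk using Nat.le_induction with
    | base => intro _; simp [hPbdiag]
    | succ k hk ih =>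
      intro hkV
      rw [Finset.sum_Ico_succ_top hk, hPbstep v k hk, ih (by omega),
        hbrec k (by omega) (by omega), Matrix.mulVec_add, Matrix.mulVec_smul,
        Matrix.mulVec_mulVec]
      abel
  have D : ∀ (s : Finset ℕ) (c : Fin n → ℝ) (w : ℕ → Fin n → ℝ),
      ∑ i, c i * (∑ u ∈ s, x u • w u) i = ∑ u ∈ s, (∑ i, c i * w u i) * x u := by
    intro s c w
    simp only [Finset.sum_apply, Pi.smul_apply, smul_eq_mul, Finset.mul_sum, Finset.sum_mul]
    rw [Finset.sum_comm]
    exact Finset.sum_congr rfl fun _ _ => Finset.sum_congr rfl fun _ _ => by ring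
  intro v h1 hV
  have hB := B v h1 (V + 1) (by omega) le_rfl
  rw [hbV, Matrix.mulVec_zero, add_zero] at hB
  have hI : Finset.Ico v (V + 1) = Finset.Icc v V := by
    ext u
    simp only [Finset.mem_Ico, Finset.mem_Icc]
    omega
  rw [hI] at hB
  rw [hy, F v hV, hB, D, D]
end
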